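/- Let m = 3, N_1 even, N_1 ≥ N_2 ≥ N_3 ≥ 3, and r ≤ N_1·⌊N_2N_3/(N_1+N_2+N_3−2)⌋. Define h(Θ̃) := vec([[U_1, [1ᵀ;Ũ_2], [1ᵀ;Ũ_3]]]) for Θ̃ = (U_1, Ũ_2, Ũ_3) with U_1 ∈ ℝ^{N_1×r}, Ũ_2 ∈ ℝ^{(N_2−1)×r}, Ũ_3 ∈ ℝ^{(N_3−1)×r}. Then for generic Θ̃, the Jacobian matrix J_h(Θ̃) has full column rank; that is, the set of Θ̃ at which J_h(Θ̃) fails to have full column rank is contained in the zero set of some nonzero polynomial in the entries of Θ̃. -/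

import Mathlib

noncomputable section

/-- Index set of the free entries of the normalized CP parameters
`Θ̃ = (U₁, Ũ₂, …, Ũ_m)`: all entries of the factor matrices except the (fixed) first rows of
the factors `2,…,m`. -/
abbrev FreeIdx (m r : ℕ) (N : Fin m → ℕ) : Type :=
  {p : Σ i : Fin m, Fin (N i) × Fin r // (p.1 : ℕ) = 0 ∨ ((p.2.1 : ℕ) ≠ 0)}

/-- Embed the normalized parameters into full factor matrices, filling the first rows of the
factors `2,…,m` with ones. -/
def embOnes {m r : ℕ} {N : Fin m → ℕ}
    (x : FreeIdx m r N → ℝ) : (i : Fin m) → Fin (N i) → Fin r → ℝ :=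
  fun i j c => if h : (i : ℕ) = 0 ∨ ((j : ℕ) ≠ 0) then x ⟨⟨i, (j, c)⟩, h⟩ else 1

/-- Entry `(i₁,…,i_m)` of the CP tensor `[[W₁,…,W_m]]`, namely `∑_{c=1}^r ∏_k W_k(i_k,c)`. -/
def cpEntry {m r : ℕ} {N : Fin m → ℕ} (W : (i : Fin m) → Fin (N i) → Fin r → ℝ)
    (idx : (i : Fin m) → Fin (N i)) : ℝ :=
  ∑ c : Fin r, ∏ i : Fin m, W i (idx i) c

/-- The (vectorized) normalized CP parametrization
`h(Θ̃) = vec([[U₁, [1ᵀ;Ũ₂], …, [1ᵀ;Ũ_m]]])`. -/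
def cpVec {m r : ℕ} {N : Fin m → ℕ} (x : FreeIdx m r N → ℝ) :
    ((i : Fin m) → Fin (N i)) → ℝ :=
  fun idx => cpEntry (embOnes x) idx

/-- generic injectivity from a single point -/
lemma gen_inj {σ α β : Type} [Fintype α] [Fintype β] [DecidableEq β]
    (L : (σ → ℝ) → (β → ℝ) →ₗ[ℝ] (α → ℝ))
    (hL : ∀ p a, ∃ P : MvPolynomial σ ℝ, ∀ x, L x (Pi.single p 1) a = MvPolynomial.eval x P)
    (S : Set β) (x0 : σ → ℝ)
    (h0 : ∀ d, (∀ p, p ∉ S → d p = 0) → L x0 d = 0 → d = 0) :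
    ∃ P : MvPolynomial σ ℝ, P ≠ 0 ∧ ∀ x, MvPolynomial.eval x P ≠ 0 →
      ∀ d, (∀ p, p ∉ S → d p = 0) → L x d = 0 → d = 0 := by
  classical
  choose Q hQ using hL
  let M : (σ → ℝ) → Matrix α S ℝ := fun x => Matrix.of fun a p => L x (Pi.single p.1 1) a
  let MP : Matrix α S (MvPolynomial σ ℝ) := Matrix.of fun a p => Q p.1 a
  have hM : ∀ x, MP.map (MvPolynomial.eval x) = M x := by
    intro x; ext a p; simp [M, MP, hQ]
  have hdet : ∀ x, MvPolynomial.eval x (MP.transpose * MP).det = ((M x).transpose * M x).det := by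
    intro x
    rw [RingHom.map_det, ← hM x]
    congr 1
    rw [RingHom.mapMatrix_apply, Matrix.map_mul, Matrix.transpose_map]
  have hLd : ∀ x d, L x d = ∑ p, d p • L x (Pi.single p 1) := by
    intro x d
    conv_lhs => rw [pi_eq_sum_univ' d]
    rw [map_sum]
    refine Finset.sum_congr rfl fun p _ => ?_
    rw [← map_smul]
  have hmul : ∀ x d, (∀ p, p ∉ S → d p = 0) → (M x).mulVec (fun p : S => d p.1) = L x d := by
    intro x d hd
    ext a
    rw [hLd]
    simp only [Matrix.mulVec, dotProduct, M, Matrix.of_apply, Finset.sum_apply, Pi.smul_apply,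
      smul_eq_mul]
    rw [← Fintype.sum_subtype_add_sum_subtype (fun p => p ∈ S)]
    rw [Finset.sum_eq_zero (s := (Finset.univ : Finset {x // ¬ x ∈ S}))]
    · rw [add_zero]
      exact Finset.sum_congr rfl fun p _ => mul_comm _ _
    · intro p _
      rw [hd p.1 p.2, zero_mul]
  refine ⟨(MP.transpose * MP).det, ?_, ?_⟩
  · intro h
    have h1 := hdet x0
    rw [h, map_zero] at h1
    obtain ⟨v, hv, hv0⟩ := Matrix.exists_mulVec_eq_zero_iff.2 h1.symm
    have h2 : (M x0).mulVec v = 0 := by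
      have := Matrix.ker_mulVecLin_transpose_mul_self (M x0)
      have h3 : v ∈ LinearMap.ker ((M x0).transpose * M x0).mulVecLin := by
        rw [LinearMap.mem_ker, Matrix.mulVecLin_apply]; exact hv0
      rw [this] at h3
      simpa using h3
    let d : β → ℝ := fun p => if h : p ∈ S then v ⟨p, h⟩ else 0
    have hd : ∀ p, p ∉ S → d p = 0 := fun p hp => by simp [d, hp]
    have hdv : (fun p : S => d p.1) = v := by ext p; simp [d]
    have := h0 d hd (by rw [← hmul x0 d hd, hdv, h2])
    apply hv
    rw [← hdv, this]; rfl
  · intro x hx d hd hLx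
    rw [hdet] at hx
    have h1 : ((M x).transpose * M x).mulVec (fun p : S => d p.1) = 0 := by
      rw [← Matrix.mulVec_mulVec, hmul x d hd, hLx, Matrix.mulVec_zero]
    have h2 := Matrix.eq_zero_of_mulVec_eq_zero hx h1
    ext p
    by_cases hp : p ∈ S
    · exact congrFun h2 ⟨p, hp⟩
    · exact hd p hp

def slab (s j : ℕ) : ℕ := if j < 2 * s then j / 2 else j - s
def swt (s j : ℕ) : ℝ := if j < 2 * s then 1 / 2 else 1

lemma swt_ne (s j : ℕ) : swt s j ≠ 0 := by unfold swt; split_ifs <;> norm_num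

lemma slab_sum (s b α : ℕ) (h : 2 * s ≤ b) (hα : α < b - s) :
    ∑ j : Fin b, (if slab s j = α then swt s j else 0) = 1 := by
  rw [Fin.sum_univ_eq_sum_range (fun j => if slab s j = α then swt s j else 0)]
  by_cases hs : α < s
  · have : ∀ j, (if slab s j = α then swt s j else 0) =
        (if j = 2 * α then (1/2 : ℝ) else 0) + (if j = 2 * α + 1 then (1/2 : ℝ) else 0) := by
      intro j
      unfold slab swt
      split_ifs <;> first | omega | norm_num
    simp only [this, Finset.sum_add_distrib, Finset.sum_ite_eq', Finset.mem_range]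
    rw [if_pos (by omega), if_pos (by omega)]; norm_num
  · have : ∀ j, (if slab s j = α then swt s j else 0) =
        (if j = α + s then (1 : ℝ) else 0) := by
      intro j
      unfold slab swt
      split_ifs <;> first | omega | norm_num
    simp only [this, Finset.sum_ite_eq', Finset.mem_range]
    rw [if_pos (by omega)]

lemma pairX (x y d0 d1 : ℝ) (p : ℝ) (h1 : d0 + x = 0) (h2 : d0 + y = 0)
    (h3 : d1 + p * x = 0) (h4 : d1 + (p + 1) * y = 0) : x = 0 ∧ y = 0 := by
  have : x = y := by linarith
  subst this
  constructor <;> linarith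

lemma core (s b c : ℕ) (hb : 2 * s ≤ b) (hc : 2 * s ≤ c)
    (X : ℕ → Fin b → ℝ) (Y : ℕ → Fin c → ℝ) (D : ℕ → ℕ → ℕ → ℝ) (Z : ℕ → ℕ → ℝ)
    (hX : ∀ l j, 2 * s ≤ l → X l j = 0) (hY : ∀ j l, 2 * s ≤ j → Y j l = 0)
    (hD : ∀ g α β, α < s → β < s → D g α β = 0)
    (sX : ∀ l, ∑ j, X l j = 0) (sY : ∀ j, ∑ l, Y j l = 0)
    (E0 : ∀ (j : Fin b) (l : Fin c), swt s j * swt s l * D 0 (slab s j) (slab s l)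
      + (if (j : ℕ) = l ∧ (j : ℕ) < 2 * s then Z 0 j else 0) + X l j + Y j l = 0)
    (E1 : ∀ (j : Fin b) (l : Fin c), swt s j * swt s l * D 1 (slab s j) (slab s l)
      + (if (j : ℕ) = l ∧ (j : ℕ) < 2 * s then Z 1 j else 0) + (l : ℕ) * X l j
      + (j : ℕ) * Y j l = 0) :
    (∀ l j, X l j = 0) ∧ (∀ j l, Y j l = 0) ∧
    (∀ α β, α < b - s → β < c - s → D 0 α β = 0 ∧ D 1 α β = 0) ∧
    (∀ p, p < 2 * s → Z 0 p = 0 ∧ Z 1 p = 0) := by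
  have hX1 : ∀ (l : ℕ) (j : Fin b), 2 * s ≤ (j : ℕ) → X l j = 0 := by
    intro l j hj
    by_cases hl : 2 * s ≤ l
    · exact hX l j hl
    have key : ∀ m, m < s → X (2 * m) j = 0 ∧ X (2 * m + 1) j = 0 := by
      intro m hm
      have a0 := E0 j ⟨2 * m, by omega⟩
      have a1 := E0 j ⟨2 * m + 1, by omega⟩
      have b0 := E1 j ⟨2 * m, by omega⟩
      have b1 := E1 j ⟨2 * m + 1, by omega⟩
      have e1 : slab s (2 * m) = m := by unfold slab; rw [if_pos (by omega)]; omega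
      have e2 : slab s (2 * m + 1) = m := by unfold slab; rw [if_pos (by omega)]; omega
      have e3 : swt s (2 * m) = 1 / 2 := by unfold swt; rw [if_pos (by omega)]
      have e4 : swt s (2 * m + 1) = 1 / 2 := by unfold swt; rw [if_pos (by omega)]
      have hn : ∀ q : ℕ, ¬ ((j : ℕ) = q ∧ (j : ℕ) < 2 * s) := by intro q; omega
      simp only [hn, if_false, e1, e2, e3, e4, hY j _ hj, mul_zero, add_zero] at a0 a1 b0 b1
      push_cast at b0 b1
      exact pairX _ _ _ _ _ a0 a1 b0 b1
    obtain ⟨q, hq | hq⟩ := Nat.even_or_odd' l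
    · rw [hq]; exact (key q (by omega)).1
    · rw [hq]; exact (key q (by omega)).2
  have hY1 : ∀ (j : ℕ) (l : Fin c), 2 * s ≤ (l : ℕ) → Y j l = 0 := by
    intro j l hl
    by_cases hj : 2 * s ≤ j
    · exact hY j l hj
    have key : ∀ m, m < s → Y (2 * m) l = 0 ∧ Y (2 * m + 1) l = 0 := by
      intro m hm
      have a0 := E0 ⟨2 * m, by omega⟩ l
      have a1 := E0 ⟨2 * m + 1, by omega⟩ l
      have b0 := E1 ⟨2 * m, by omega⟩ l
      have b1 := E1 ⟨2 * m + 1, by omega⟩ l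
      have e1 : slab s (2 * m) = m := by unfold slab; rw [if_pos (by omega)]; omega
      have e2 : slab s (2 * m + 1) = m := by unfold slab; rw [if_pos (by omega)]; omega
      have e3 : swt s (2 * m) = 1 / 2 := by unfold swt; rw [if_pos (by omega)]
      have e4 : swt s (2 * m + 1) = 1 / 2 := by unfold swt; rw [if_pos (by omega)]
      have hn : ∀ q : ℕ, ¬ (q = (l : ℕ) ∧ q < 2 * s) := by intro q; omega
      simp only [hn, if_false, e1, e2, e3, e4, hX l _ hl, mul_zero, add_zero] at a0 a1 b0 b1
      push_cast at b0 b1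
      exact pairX _ _ _ _ _ a0 a1 b0 b1
    obtain ⟨q, hq | hq⟩ := Nat.even_or_odd' j
    · rw [hq]; exact (key q (by omega)).1
    · rw [hq]; exact (key q (by omega)).2
  have hXY : ∀ (j : Fin b) (l : Fin c), (j : ℕ) < 2 * s → (l : ℕ) < 2 * s → (j : ℕ) ≠ l →
      X l j = 0 ∧ Y j l = 0 := by
    intro j l hj hl hne
    have a := E0 j l
    have b := E1 j l
    have e : ∀ g, D g (slab s j) (slab s l) = 0 := by
      intro g
      apply hD <;> unfold slab <;> rw [if_pos (by omega)] <;> omega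
    rw [e, if_neg (by omega)] at a b
    have hne' : ((l : ℕ) : ℝ) - ((j : ℕ) : ℝ) ≠ 0 := by
      rw [sub_ne_zero]; exact_mod_cast hne.symm
    have hx : (((l : ℕ) : ℝ) - ((j : ℕ) : ℝ)) * X l j = 0 := by linear_combination b - (j : ℕ) * a
    have hx0 := (mul_eq_zero.1 hx).resolve_left hne'
    exact ⟨hx0, by rw [hx0] at a; linarith⟩
  have hX2 : ∀ l j, X l j = 0 := by
    have off : ∀ (l : ℕ) (j : Fin b), l < 2 * s → (j : ℕ) ≠ l → X l j = 0 := by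
      intro l j hl hne
      by_cases hj : 2 * s ≤ (j : ℕ)
      · exact hX1 l j hj
      · exact (hXY j ⟨l, by omega⟩ (by omega) hl hne).1
    intro l j
    by_cases hl : 2 * s ≤ l
    · exact hX l j hl
    by_cases hne : (j : ℕ) = l
    · have := sX l
      rwa [Finset.sum_eq_single j (fun j' _ h => off l j' (by omega)
        (fun h' => h (Fin.ext (by omega)))) (by simp)] at this
    · exact off l j (by omega) hne
  have hY2 : ∀ j l, Y j l = 0 := by
    have off : ∀ (j : ℕ) (l : Fin c), j < 2 * s → (l : ℕ) ≠ j → Y j l = 0 := by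
      intro j l hj hne
      by_cases hl : 2 * s ≤ (l : ℕ)
      · exact hY1 j l hl
      · exact (hXY ⟨j, by omega⟩ l hj (by omega) (fun h => hne h.symm)).2
    intro j l
    by_cases hj : 2 * s ≤ j
    · exact hY j l hj
    by_cases hne : (l : ℕ) = j
    · have := sY j
      rwa [Finset.sum_eq_single l (fun j' _ h => off j j' (by omega)
        (fun h' => h (Fin.ext (by omega)))) (by simp)] at this
    · exact off j l (by omega) hne
  simp only [hX2, hY2, mul_zero, add_zero] at E0 E1
  refine ⟨hX2, hY2, ?_, ?_⟩
  · intro α β hα hβ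
    by_cases hs : α < s ∧ β < s
    · exact ⟨hD _ _ _ hs.1 hs.2, hD _ _ _ hs.1 hs.2⟩
    have : ∃ (j : Fin b) (l : Fin c), slab s j = α ∧ slab s l = β ∧
        ¬ ((j : ℕ) = l ∧ (j : ℕ) < 2 * s) := by
      refine ⟨⟨if α < s then 2 * α else α + s, by split_ifs <;> omega⟩,
        ⟨if β < s then 2 * β else β + s, by split_ifs <;> omega⟩, ?_, ?_, ?_⟩
      · unfold slab; simp only; split_ifs <;> omega
      · unfold slab; simp only; split_ifs <;> omega
      · simp only; split_ifs <;> omega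
    obtain ⟨j, l, rfl, rfl, hn⟩ := this
    have a := E0 j l
    have b := E1 j l
    rw [if_neg hn, add_zero] at a b
    have hw := mul_ne_zero (swt_ne s j) (swt_ne s l)
    exact ⟨(mul_eq_zero.1 a).resolve_left hw, (mul_eq_zero.1 b).resolve_left hw⟩
  · intro p hp
    have a := E0 ⟨p, by omega⟩ ⟨p, by omega⟩
    have b := E1 ⟨p, by omega⟩ ⟨p, by omega⟩
    have e : ∀ g, D g (slab s p) (slab s p) = 0 := by
      intro g
      apply hD <;> unfold slab <;> rw [if_pos (by omega)] <;> omega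
    simp only [e, hp, and_self, if_true, mul_zero, zero_add] at a b
    exact ⟨a, b⟩

/-- tangent version of `embOnes` -/
def embZ {m r : ℕ} {N : Fin m → ℕ}
    (x : FreeIdx m r N → ℝ) : (i : Fin m) → Fin (N i) → Fin r → ℝ :=
  fun i j c => if h : (i : ℕ) = 0 ∨ ((j : ℕ) ≠ 0) then x ⟨⟨i, (j, c)⟩, h⟩ else 0

/-- the Jacobian with the first factor decoupled -/
def JL {r : ℕ} {N : Fin 3 → ℕ} (U : Fin (N 0) → Fin r → ℝ) (x : FreeIdx 3 r N → ℝ) :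
    (FreeIdx 3 r N → ℝ) →ₗ[ℝ] (((i : Fin 3) → Fin (N i)) → ℝ) where
  toFun d idx := ∑ c : Fin r, (embZ d 0 (idx 0) c * embOnes x 1 (idx 1) c * embOnes x 2 (idx 2) c
    + U (idx 0) c * (embZ d 1 (idx 1) c * embOnes x 2 (idx 2) c
      + embOnes x 1 (idx 1) c * embZ d 2 (idx 2) c))
  map_add' d e := by
    ext idx
    have : ∀ i j c, embZ (d + e) i j c = embZ d i j c + embZ e i j c := by
      intro i j c; unfold embZ; split_ifs <;> simp
    simp only [this, Pi.add_apply, ← Finset.sum_add_distrib]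
    exact Finset.sum_congr rfl fun c _ => by ring
  map_smul' a d := by
    ext idx
    have : ∀ i j c, embZ (a • d) i j c = a * embZ d i j c := by
      intro i j c; unfold embZ; split_ifs <;> simp
    simp only [this, Pi.smul_apply, smul_eq_mul, Finset.mul_sum, RingHom.id_apply]
    exact Finset.sum_congr rfl fun c _ => by ring

lemma JL_apply {r : ℕ} {N : Fin 3 → ℕ} (U : Fin (N 0) → Fin r → ℝ) (x d : FreeIdx 3 r N → ℝ)
    (idx : (i : Fin 3) → Fin (N i)) : JL U x d idx =
    ∑ c : Fin r, (embZ d 0 (idx 0) c * embOnes x 1 (idx 1) c * embOnes x 2 (idx 2) c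
    + U (idx 0) c * (embZ d 1 (idx 1) c * embOnes x 2 (idx 2) c
      + embOnes x 1 (idx 1) c * embZ d 2 (idx 2) c)) := rfl

lemma hasFDerivAt_embOnes {r : ℕ} {N : Fin 3 → ℕ} (x : FreeIdx 3 r N → ℝ) (i j c) :
    ∃ f : (FreeIdx 3 r N → ℝ) →L[ℝ] ℝ,
      HasFDerivAt (fun x : FreeIdx 3 r N → ℝ => embOnes x i j c) f x ∧
      ∀ d, f d = embZ d i j c := by
  by_cases h : (i : ℕ) = 0 ∨ ((j : ℕ) ≠ 0)
  · refine ⟨ContinuousLinearMap.proj ⟨⟨i, (j, c)⟩, h⟩, ?_, ?_⟩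
    · simp only [embOnes, dif_pos h]
      exact hasFDerivAt_apply _ _
    · intro d; simp only [embZ, dif_pos h]; rfl
  · refine ⟨0, ?_, ?_⟩
    · simp only [embOnes, dif_neg h]
      exact hasFDerivAt_const _ _
    · intro d; simp only [embZ, dif_neg h]; rfl

lemma fderiv_cpVec {r : ℕ} {N : Fin 3 → ℕ} (x d : FreeIdx 3 r N → ℝ) :
    fderiv ℝ (cpVec (m := 3) (r := r) (N := N)) x d = JL (embOnes x 0) x d := by
  choose f hf hfd using fun (i : Fin 3) (j : Fin (N i)) (c : Fin r) => hasFDerivAt_embOnes x i j c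
  have key : ∀ idx : (i : Fin 3) → Fin (N i), ∃ F : (FreeIdx 3 r N → ℝ) →L[ℝ] ℝ,
      HasFDerivAt (fun x : FreeIdx 3 r N → ℝ => cpVec x idx) F x ∧
      ∀ d, F d = JL (embOnes x 0) x d idx := by
    intro idx
    have h1 := HasFDerivAt.fun_sum (u := (Finset.univ : Finset (Fin r))) (fun c _ =>
      ((hf 0 (idx 0) c).mul (hf 1 (idx 1) c)).mul (hf 2 (idx 2) c))
    refine ⟨_, by simp only [cpVec, cpEntry, Fin.prod_univ_three]; exact h1, ?_⟩
    · intro d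
      simp only [JL_apply, ContinuousLinearMap.sum_apply, ContinuousLinearMap.add_apply,
        ContinuousLinearMap.smul_apply, smul_eq_mul, hfd]
      exact Finset.sum_congr rfl fun c _ => by simp only [Pi.mul_apply]; ring
  choose F hF hFd using key
  have h : HasFDerivAt (cpVec (m := 3) (r := r) (N := N)) (ContinuousLinearMap.pi F) x :=
    hasFDerivAt_pi.2 hF
  rw [h.fderiv]
  ext idx
  rw [← hFd]; rfl

/-- polynomial functions -/
def IsPolyFn {σ : Type} (f : (σ → ℝ) → ℝ) : Prop :=
  ∃ P : MvPolynomial σ ℝ, ∀ x, f x = MvPolynomial.eval x P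

lemma IsPolyFn.const {σ : Type} (a : ℝ) : IsPolyFn (fun _ : σ → ℝ => a) :=
  ⟨MvPolynomial.C a, fun x => by simp⟩
lemma IsPolyFn.add {σ : Type} {f g : (σ → ℝ) → ℝ} (hf : IsPolyFn f) (hg : IsPolyFn g) :
    IsPolyFn (fun x => f x + g x) := by
  obtain ⟨P, hP⟩ := hf
  obtain ⟨Q, hQ⟩ := hg
  exact ⟨P + Q, fun x => by simp [hP, hQ]⟩
lemma IsPolyFn.mul {σ : Type} {f g : (σ → ℝ) → ℝ} (hf : IsPolyFn f) (hg : IsPolyFn g) :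
    IsPolyFn (fun x => f x * g x) := by
  obtain ⟨P, hP⟩ := hf
  obtain ⟨Q, hQ⟩ := hg
  exact ⟨P * Q, fun x => by simp [hP, hQ]⟩
lemma IsPolyFn.sum {σ ι : Type} [Fintype ι] {f : ι → (σ → ℝ) → ℝ} (hf : ∀ i, IsPolyFn (f i)) :
    IsPolyFn (fun x => ∑ i, f i x) := by
  choose P hP using hf
  exact ⟨∑ i, P i, fun x => by simp [hP]⟩
lemma IsPolyFn.emb {r : ℕ} {N : Fin 3 → ℕ} (i j c) :
    IsPolyFn (fun x : FreeIdx 3 r N → ℝ => embOnes x i j c) := by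
  by_cases h : (i : ℕ) = 0 ∨ ((j : ℕ) ≠ 0)
  · exact ⟨MvPolynomial.X ⟨⟨i, (j, c)⟩, h⟩, fun x => by simp only [embOnes, dif_pos h, MvPolynomial.eval_X]⟩
  · exact ⟨1, fun x => by simp only [embOnes, dif_neg h, map_one]⟩

lemma JL_poly {r : ℕ} {N : Fin 3 → ℕ} (U : (FreeIdx 3 r N → ℝ) → Fin (N 0) → Fin r → ℝ)
    (hU : ∀ i c, IsPolyFn (fun x => U x i c)) (d : FreeIdx 3 r N → ℝ) (idx) :
    IsPolyFn (fun x => JL (U x) x d idx) := by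
  simp only [JL_apply]
  refine IsPolyFn.sum fun c => ?_
  refine ((((IsPolyFn.const _).mul (IsPolyFn.emb _ _ _)).mul (IsPolyFn.emb _ _ _))).add ?_
  exact (hU _ _).mul (((IsPolyFn.const _).mul (IsPolyFn.emb _ _ _)).add
    ((IsPolyFn.emb _ _ _).mul (IsPolyFn.const _)))

def mkIdx {N : Fin 3 → ℕ} (i : Fin (N 0)) (j : Fin (N 1)) (l : Fin (N 2)) :
    (q : Fin 3) → Fin (N q)
  | 0 => i
  | 1 => j
  | 2 => l

/-- block-specialized first factor -/
def Ust (t i c : ℕ) : ℝ := if i / 2 = c / t then (if i % 2 = 0 then 1 else ((c % t : ℕ) : ℝ)) else 0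

def Sblk {r : ℕ} {N : Fin 3 → ℕ} (t k : ℕ) : Set (FreeIdx 3 r N) :=
  {p | if (p.1.1 : ℕ) = 0 then (p.1.2.1 : ℕ) / 2 = k else (p.1.2.2 : ℕ) / t = k}

def basisChange {n : ℕ} : (Fin n → ℝ) →ₗ[ℝ] (Fin n → ℝ) where
  toFun f j := if (j : ℕ) = 0 then f j - ∑ j' : Fin n, (if (j' : ℕ) = 0 then 0 else f j') else f j
  map_add' f g := by
    ext j
    simp only [Pi.add_apply]
    have : ∀ j' : Fin n, (if (j' : ℕ) = 0 then 0 else f j' + g j') =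
      (if (j' : ℕ) = 0 then 0 else f j') + (if (j' : ℕ) = 0 then 0 else g j') := by
      intro j'; split_ifs <;> simp
    simp only [this, Finset.sum_add_distrib]
    split_ifs <;> ring
  map_smul' a f := by
    ext j
    simp only [Pi.smul_apply, smul_eq_mul, RingHom.id_apply]
    have : ∀ j' : Fin n, (if (j' : ℕ) = 0 then 0 else a * f j') =
      a * (if (j' : ℕ) = 0 then 0 else f j') := by
      intro j'; split_ifs <;> simp
    simp only [this, ← Finset.mul_sum]
    split_ifs <;> ring

lemma basisChange_apply {n : ℕ} (f : Fin n → ℝ) (j : Fin n) : basisChange f j =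
    if (j : ℕ) = 0 then f j - ∑ j' : Fin n, (if (j' : ℕ) = 0 then 0 else f j') else f j := rfl

lemma sum_split0 {n : ℕ} (hn : 0 < n) (f : Fin n → ℝ) :
    ∑ j, f j = f ⟨0, hn⟩ + ∑ j' : Fin n, (if (j' : ℕ) = 0 then 0 else f j') := by
  have : ∀ j : Fin n, f j = (if j = ⟨0, hn⟩ then f j else 0) + (if (j : ℕ) = 0 then 0 else f j) := by
    intro j
    by_cases h : (j : ℕ) = 0
    · simp [h, Fin.ext_iff]
    · simp [h, Fin.ext_iff]
  rw [Finset.sum_congr rfl fun j _ => this j, Finset.sum_add_distrib]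
  simp

lemma basisChange_sum {n : ℕ} (hn : 0 < n) (f : Fin n → ℝ) :
    ∑ j, basisChange f j = f ⟨0, hn⟩ := by
  rw [sum_split0 hn]
  have : ∀ j' : Fin n, (if (j' : ℕ) = 0 then 0 else basisChange f j') =
      (if (j' : ℕ) = 0 then 0 else f j') := by
    intro j'; rw [basisChange_apply]; split_ifs <;> rfl
  simp only [this]
  rw [basisChange_apply]
  simp

lemma basisChange_of {n : ℕ} (hn : 0 < n) (v f : Fin n → ℝ) (hv : ∑ j, v j = 1)
    (hf : ∀ j, f j = if (j : ℕ) = 0 then 1 else v j) : basisChange f = v := by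
  ext j
  rw [basisChange_apply]
  split_ifs with h
  · have h1 : ∀ j' : Fin n, (if (j' : ℕ) = 0 then 0 else f j') =
      (if (j' : ℕ) = 0 then 0 else v j') := by
      intro j'; rw [hf]; split_ifs <;> rfl
    simp only [h1]
    rw [hf, if_pos h]
    have := sum_split0 hn v
    have hj : j = ⟨0, hn⟩ := Fin.ext h
    rw [hj]; linarith
  · rw [hf, if_neg h]

lemma bil_change {r b c : ℕ} (A : (Fin b → ℝ) →ₗ[ℝ] (Fin b → ℝ))
    (B : (Fin c → ℝ) →ₗ[ℝ] (Fin c → ℝ)) (a u : Fin r → ℝ) (v dv : Fin r → Fin b → ℝ)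
    (w dw : Fin r → Fin c → ℝ)
    (h : ∀ j l, ∑ q, (a q * v q j * w q l + u q * (dv q j * w q l + v q j * dw q l)) = 0) :
    ∀ j l, ∑ q, (a q * A (v q) j * B (w q) l + u q * (A (dv q) j * B (w q) l
      + A (v q) j * B (dw q) l)) = 0 := by
  have h1 : ∀ j l, ∑ q, (a q * A (v q) j * w q l + u q * (A (dv q) j * w q l
      + A (v q) j * dw q l)) = 0 := by
    intro j l
    have : ∑ q, ((a q * w q l + u q * dw q l) • v q + (u q * w q l) • dv q) = 0 := by
      ext j
      rw [Finset.sum_apply, Pi.zero_apply, ← h j l]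
      exact Finset.sum_congr rfl fun q _ => by simp; ring
    have := congrFun (congrArg A this) j
    rw [map_sum, map_zero, Finset.sum_apply, Pi.zero_apply] at this
    rw [← this]
    exact Finset.sum_congr rfl fun q _ => by simp; ring
  intro j l
  have : ∑ q, ((a q * A (v q) j + u q * A (dv q) j) • w q + (u q * A (v q) j) • dw q) = 0 := by
    ext l
    rw [Finset.sum_apply, Pi.zero_apply, ← h1 j l]
    exact Finset.sum_congr rfl fun q _ => by simp; ring
  have := congrFun (congrArg B this) l
  rw [map_sum, map_zero, Finset.sum_apply, Pi.zero_apply] at this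
  rw [← this]
  exact Finset.sum_congr rfl fun q _ => by simp; ring

lemma slots_exist (r A s b c k : ℕ) (hs : 0 < s) (hk : k < A) (hr : r ≤ A * (2 * s))
    (hb : 2 * s ≤ b) (hc : 2 * s ≤ c) (hcount : s * (2 * A + b + c - 2) ≤ b * c) :
    ∃ α β : ℕ → ℕ, (∀ q, q < r → q / (2 * s) ≠ k →
      α q < b - s ∧ β q < c - s ∧ ¬ (α q < s ∧ β q < s)) ∧
      ∀ q q', q < r → q' < r → q / (2 * s) ≠ k → q' / (2 * s) ≠ k → α q = α q' → β q = β q' →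
        q = q' := by
  classical
  let O : Finset ℕ := (Finset.range r).filter fun q => q / (2 * s) ≠ k
  let T : Finset (ℕ × ℕ) :=
    (Finset.range (b - s) ×ˢ Finset.range (c - s)) \ (Finset.range s ×ˢ Finset.range s)
  have hO : O.card ≤ (A - 1) * (2 * s) := by
    have : O.card ≤ (((Finset.range A).erase k) ×ˢ Finset.range (2 * s)).card := by
      apply Finset.card_le_card_of_injOn (fun q => (q / (2 * s), q % (2 * s)))
      · intro q hq
        simp only [O, Finset.coe_filter, Finset.mem_range, Set.mem_setOf_eq] at hq
        simp only [Finset.coe_product, Set.mem_prod, Finset.mem_coe, Finset.mem_erase,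
          Finset.mem_range]
        refine ⟨⟨hq.2, ?_⟩, Nat.mod_lt _ (by omega)⟩
        rw [Nat.div_lt_iff_lt_mul (by omega)]
        omega
      · intro q _ q' _ h
        simp only [Prod.mk.injEq] at h
        rw [← Nat.div_add_mod q (2 * s), h.1, h.2, Nat.div_add_mod]
    rwa [Finset.card_product, Finset.card_erase_of_mem (by simpa using hk), Finset.card_range,
      Finset.card_range] at this
  have hT : T.card = (b - s) * (c - s) - s * s := by
    rw [Finset.card_sdiff_of_subset, Finset.card_product, Finset.card_product]
    · simp
    · apply Finset.product_subset_product <;> apply Finset.range_subset_range.2 <;> omega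
  have hle : O.card ≤ T.card := by
    rw [hT]
    refine hO.trans ?_
    obtain ⟨A', rfl⟩ : ∃ A', A = A' + 1 := ⟨A - 1, by omega⟩
    obtain ⟨b', rfl⟩ := Nat.exists_eq_add_of_le hb
    obtain ⟨c', rfl⟩ := Nat.exists_eq_add_of_le hc
    have e1 : 2 * (A' + 1) + (2 * s + b') + (2 * s + c') - 2 = 2 * A' + 4 * s + b' + c' := by omega
    have e2 : 2 * s + b' - s = s + b' := by omega
    have e3 : 2 * s + c' - s = s + c' := by omega
    rw [e1] at hcount
    rw [e2, e3]
    apply Nat.le_sub_of_add_le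
    simp only [Nat.add_sub_cancel]
    nlinarith
  obtain ⟨f⟩ : Nonempty (O ↪ T) := Function.Embedding.nonempty_of_card_le (by simpa using hle)
  refine ⟨fun q => if h : q ∈ O then (f ⟨q, h⟩).1.1 else 0,
    fun q => if h : q ∈ O then (f ⟨q, h⟩).1.2 else 0, ?_, ?_⟩
  · intro q hq hqk
    have hm : q ∈ O := by simp [O, hq, hqk]
    simp only [dif_pos hm]
    have := (f ⟨q, hm⟩).2
    simp only [T, Finset.mem_sdiff, Finset.mem_product, Finset.mem_range] at this
    tauto
  · intro q q' hq hq' hqk hqk' h1 h2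
    have hm : q ∈ O := by simp [O, hq, hqk]
    have hm' : q' ∈ O := by simp [O, hq', hqk']
    simp only [dif_pos hm, dif_pos hm'] at h1 h2
    have := f.injective (Subtype.ext (Prod.ext h1 h2))
    simpa using this

/-- witness vectors (in the changed basis) -/
def wit (s k : ℕ) (α : ℕ → ℕ) (j q : ℕ) : ℝ :=
  if q / (2 * s) = k then (if j = q % (2 * s) then 1 else 0)
  else (if slab s j = α q then swt s j else 0)

lemma wit_sum (s k b q : ℕ) (hs : 0 < s) (α : ℕ → ℕ) (hb : 2 * s ≤ b)
    (hα : q / (2 * s) ≠ k → α q < b - s) : ∑ j : Fin b, wit s k α j q = 1 := by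
  unfold wit
  by_cases h : q / (2 * s) = k
  · simp only [if_pos h]
    have hlt : q % (2 * s) < b := (Nat.mod_lt _ (by omega)).trans_le hb
    rw [Finset.sum_eq_single (⟨q % (2 * s), hlt⟩ : Fin b)]
    · simp
    · intro j _ hj
      rw [if_neg]
      intro h'; exact hj (Fin.ext h')
    · simp
  · simp only [if_neg h]
    exact slab_sum s b _ hb (hα h)

lemma block_alg (r s b c k : ℕ) (hs : 0 < s) (hb : 2 * s ≤ b) (hc : 2 * s ≤ c)
    (α β : ℕ → ℕ)
    (h1 : ∀ q, q < r → q / (2 * s) ≠ k → α q < b - s ∧ β q < c - s ∧ ¬ (α q < s ∧ β q < s))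
    (h2 : ∀ q q', q < r → q' < r → q / (2 * s) ≠ k → q' / (2 * s) ≠ k → α q = α q' → β q = β q' →
        q = q')
    (dU : ℕ → Fin r → ℝ) (dV : Fin r → Fin b → ℝ) (dW : Fin r → Fin c → ℝ)
    (sV : ∀ q, ∑ j, dV q j = 0) (sW : ∀ q, ∑ l, dW q l = 0)
    (E : ∀ g, g < 2 → ∀ (j : Fin b) (l : Fin c), ∑ q : Fin r, (dU g q * wit s k α j q * wit s k β l q
      + Ust (2 * s) (2 * k + g) q * (dV q j * wit s k β l q + wit s k α j q * dW q l)) = 0) :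
    (∀ q, dU 0 q = 0 ∧ dU 1 q = 0) ∧
    ∀ q : Fin r, (q : ℕ) / (2 * s) = k → dV q = 0 ∧ dW q = 0 := by
  classical
  let X : ℕ → Fin b → ℝ := fun l j => ∑ q : Fin r,
    if (q : ℕ) / (2 * s) = k ∧ (q : ℕ) % (2 * s) = l then dV q j else 0
  let Y : ℕ → Fin c → ℝ := fun j l => ∑ q : Fin r,
    if (q : ℕ) / (2 * s) = k ∧ (q : ℕ) % (2 * s) = j then dW q l else 0
  let Z : ℕ → ℕ → ℝ := fun g p => ∑ q : Fin r,
    if (q : ℕ) / (2 * s) = k ∧ (q : ℕ) % (2 * s) = p then dU g q else 0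
  let D : ℕ → ℕ → ℕ → ℝ := fun g a e => ∑ q : Fin r,
    if (q : ℕ) / (2 * s) ≠ k ∧ α q = a ∧ β q = e then dU g q else 0
  have hlt : ∀ q : ℕ, q % (2 * s) < 2 * s := fun q => Nat.mod_lt _ (by omega)
  have expand : ∀ g, g < 2 → ∀ (j : Fin b) (l : Fin c),
      swt s j * swt s l * D g (slab s j) (slab s l)
      + (if (j : ℕ) = l ∧ (j : ℕ) < 2 * s then Z g j else 0)
      + (if g = 0 then 1 else ((l : ℕ) : ℝ)) * X l j
      + (if g = 0 then 1 else ((j : ℕ) : ℝ)) * Y j l = 0 := by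
    intro g hg j l
    refine Eq.trans ?_ (E g hg j l)
    have hZ : (if (j : ℕ) = l ∧ (j : ℕ) < 2 * s then Z g j else 0) = ∑ q : Fin r,
        if (j : ℕ) = l ∧ (q : ℕ) / (2 * s) = k ∧ (q : ℕ) % (2 * s) = j then dU g q else 0 := by
      by_cases h : (j : ℕ) = l
      · by_cases h' : (j : ℕ) < 2 * s
        · simp [h, h', Z]
          intro h''; omega
        · rw [if_neg (by tauto)]
          symm
          apply Finset.sum_eq_zero
          intro q _
          rw [if_neg]
          have := hlt q
          omega
      · simp [h]
    rw [hZ]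
    simp only [D, X, Y, Finset.mul_sum, ← Finset.sum_add_distrib]
    refine Finset.sum_congr rfl fun q _ => ?_
    by_cases hq : (q : ℕ) / (2 * s) = k
    · have hU : Ust (2 * s) (2 * k + g) q = if g = 0 then 1 else (((q : ℕ) % (2 * s) : ℕ) : ℝ) := by
        unfold Ust
        rw [if_pos (by omega)]
        have : (2 * k + g) % 2 = g := by omega
        rw [this]
      rw [hU]
      simp only [wit, hq, if_true, true_and, ne_eq, not_true_eq_false, false_and, if_false]
      by_cases hj : (j : ℕ) = (q : ℕ) % (2 * s) <;> by_cases hl : (l : ℕ) = (q : ℕ) % (2 * s)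
      · simp [hj, hl]; split_ifs <;> ring
      · have hl' : ¬ (q : ℕ) % (2 * s) = l := fun h => hl h.symm
        simp [hj, hl, hl']
      · have hj' : ¬ (q : ℕ) % (2 * s) = j := fun h => hj h.symm
        simp [hj, hl, hj']
      · have hl' : ¬ (q : ℕ) % (2 * s) = l := fun h => hl h.symm
        have hj' : ¬ (q : ℕ) % (2 * s) = j := fun h => hj h.symm
        simp [hj, hl, hj', hl']
    · have hU : Ust (2 * s) (2 * k + g) q = 0 := by
        unfold Ust
        rw [if_neg (by omega)]
      rw [hU]
      simp only [wit, hq, if_false, false_and, and_false, ne_eq, not_false_eq_true, true_and,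
        mul_zero, zero_mul, add_zero]
      by_cases hj : slab s j = α q <;> by_cases hl : slab s l = β q
      · simp [hj, hl]; ring
      · have hl' : ¬ β q = slab s l := fun h => hl h.symm
        simp [hl, hl']
      · have hj' : ¬ α q = slab s j := fun h => hj h.symm
        simp [hj, hj']
      · have hj' : ¬ α q = slab s j := fun h => hj h.symm
        simp [hj, hj']
  have C := core s b c hb hc X Y D Z ?_ ?_ ?_ ?_ ?_ ?_ ?_
  · obtain ⟨cX, cY, cD, cZ⟩ := C
    have inj : ∀ q q' : Fin r, (q : ℕ) / (2 * s) = k → (q' : ℕ) / (2 * s) = k →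
        (q' : ℕ) % (2 * s) = (q : ℕ) % (2 * s) → q' = q := by
      intro q q' e e' e''
      apply Fin.ext
      rw [← Nat.div_add_mod q' (2 * s), e', e'', ← e, Nat.div_add_mod]
    have collapse : ∀ (f : Fin r → ℝ) (q : Fin r), (q : ℕ) / (2 * s) = k →
        (∑ q' : Fin r, if (q' : ℕ) / (2 * s) = k ∧ (q' : ℕ) % (2 * s) = (q : ℕ) % (2 * s)
          then f q' else 0) = f q := by
      intro f q hq
      rw [Finset.sum_eq_single q]
      · simp [hq]
      · intro q' _ hne
        rw [if_neg]
        rintro ⟨e, e'⟩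
        exact hne (inj q q' hq e e')
      · simp
    have collapseD : ∀ (f : Fin r → ℝ) (q : Fin r), (q : ℕ) / (2 * s) ≠ k →
        (∑ q' : Fin r, if (q' : ℕ) / (2 * s) ≠ k ∧ α q' = α q ∧ β q' = β q
          then f q' else 0) = f q := by
      intro f q hq
      rw [Finset.sum_eq_single q]
      · simp [hq]
      · intro q' _ hne
        rw [if_neg]
        rintro ⟨e, e', e''⟩
        exact hne (Fin.ext (h2 _ _ q'.2 q.2 e hq e' e''))
      · simp
    refine ⟨?_, ?_⟩
    · intro q
      by_cases hq : (q : ℕ) / (2 * s) = k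
      · have := cZ ((q : ℕ) % (2 * s)) (hlt q)
        rw [← collapse (dU 0) q hq, ← collapse (dU 1) q hq]
        exact this
      · have := cD (α q) (β q) (h1 q q.2 hq).1 (h1 q q.2 hq).2.1
        rw [← collapseD (dU 0) q hq, ← collapseD (dU 1) q hq]
        exact this
    · intro q hq
      constructor
      · ext j
        rw [← collapse (fun q => dV q j) q hq]
        exact cX _ _
      · ext l
        rw [← collapse (fun q => dW q l) q hq]
        exact cY _ _
  · intro l j hl
    apply Finset.sum_eq_zero
    intro q _
    rw [if_neg]
    have := hlt q
    omega
  · intro l j hl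
    apply Finset.sum_eq_zero
    intro q _
    rw [if_neg]
    have := hlt q
    omega
  · intro g a e ha he
    apply Finset.sum_eq_zero
    intro q _
    rw [if_neg]
    rintro ⟨hq, rfl, rfl⟩
    exact (h1 q q.2 hq).2.2 ⟨ha, he⟩
  · intro l
    simp only [X]
    rw [Finset.sum_comm]
    apply Finset.sum_eq_zero
    intro q _
    split_ifs
    · exact sV q
    · simp
  · intro l
    simp only [Y]
    rw [Finset.sum_comm]
    apply Finset.sum_eq_zero
    intro q _
    split_ifs
    · exact sW q
    · simp
  · intro j l
    simpa using expand 0 (by omega) j l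
  · intro j l
    simpa using expand 1 (by omega) j l

lemma block_inj {r : ℕ} {N : Fin 3 → ℕ} (A s k : ℕ) (hs : 0 < s) (hk : k < A) (hN : N 0 = 2 * A)
    (hr : r ≤ A * (2 * s)) (hb : 2 * s ≤ N 1) (hc : 2 * s ≤ N 2)
    (hcount : s * (2 * A + N 1 + N 2 - 2) ≤ N 1 * N 2) :
    ∃ x0 : FreeIdx 3 r N → ℝ, ∀ d, (∀ p, p ∉ Sblk (2 * s) k → d p = 0) →
      JL (fun i c => Ust (2 * s) i c) x0 d = 0 → d = 0 := by
  obtain ⟨α, β, h1, h2⟩ := slots_exist r A s (N 1) (N 2) k hs hk hr hb hc hcount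
  have p1 : 0 < N 1 := by omega
  have p2 : 0 < N 2 := by omega
  refine ⟨fun p => if (p.1.1 : ℕ) = 1 then wit s k α p.1.2.1 p.1.2.2
    else wit s k β p.1.2.1 p.1.2.2, ?_⟩
  intro d hd hJ
  set x0 : FreeIdx 3 r N → ℝ := fun p => if (p.1.1 : ℕ) = 1 then wit s k α p.1.2.1 p.1.2.2
    else wit s k β p.1.2.1 p.1.2.2 with hx0
  have bv : ∀ q : Fin r, basisChange (fun j => embOnes x0 1 j q) = fun j : Fin (N 1) => wit s k α j q := by
    intro q
    apply basisChange_of p1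
    · exact wit_sum s k (N 1) q hs α hb (fun h => (h1 q q.2 h).1)
    · intro j
      by_cases hj : (j : ℕ) = 0 <;> simp [embOnes, hj, hx0]
  have bw : ∀ q : Fin r, basisChange (fun j => embOnes x0 2 j q) = fun j : Fin (N 2) => wit s k β j q := by
    intro q
    apply basisChange_of p2
    · exact wit_sum s k (N 2) q hs β hc (fun h => (h1 q q.2 h).2.1)
    · intro j
      by_cases hj : (j : ℕ) = 0 <;> simp [embOnes, hj, hx0]
  have key := block_alg r s (N 1) (N 2) k hs hb hc α β h1 h2
    (fun g q => if h : 2 * k + g < N 0 then embZ d 0 ⟨2 * k + g, h⟩ q else 0)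
    (fun q => basisChange (fun j => embZ d 1 j q)) (fun q => basisChange (fun j => embZ d 2 j q))
    ?_ ?_ ?_
  · obtain ⟨kU, kV⟩ := key
    have hz : ∀ {n : ℕ} (f : Fin n → ℝ), basisChange f = 0 → ∀ j : Fin n, (j : ℕ) ≠ 0 → f j = 0 := by
      intro n f hf j hj
      have := congrFun hf j
      rwa [basisChange_apply, if_neg hj] at this
    ext p
    by_cases hp : p ∈ Sblk (2 * s) k
    swap
    · exact hd p hp
    obtain ⟨⟨i, j, c⟩, h⟩ := p
    fin_cases i
    · have hj : (j : ℕ) / 2 = k := by simpa [Sblk] using hp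
      have hjlt : (j : ℕ) < N 0 := j.2
      have e0 := kU c
      have e : embZ d 0 j c = 0 := by
        rcases Nat.mod_two_eq_zero_or_one (j : ℕ) with hm | hm
        · have e1 : 2 * k + 0 < N 0 := by omega
          have e2 : (⟨2 * k + 0, e1⟩ : Fin (N 0)) = j := Fin.ext (by simp only; omega)
          have := e0.1
          rwa [dif_pos e1, e2] at this
        · have e1 : 2 * k + 1 < N 0 := by omega
          have e2 : (⟨2 * k + 1, e1⟩ : Fin (N 0)) = j := Fin.ext (by simp only; omega)
          have := e0.2
          rwa [dif_pos e1, e2] at this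
      simpa [embZ] using e
    · have hq : (c : ℕ) / (2 * s) = k := by simpa [Sblk] using hp
      have hj : (j : ℕ) ≠ 0 := by simpa using h
      have e := hz _ (kV c hq).1 j hj
      simpa [embZ, hj] using e
    · have hq : (c : ℕ) / (2 * s) = k := by simpa [Sblk] using hp
      have hj : (j : ℕ) ≠ 0 := by simpa using h
      have e := hz _ (kV c hq).2 j hj
      simpa [embZ, hj] using e
  · intro q
    rw [basisChange_sum p1]
    simp [embZ]
  · intro q
    rw [basisChange_sum p2]
    simp [embZ]
  · intro g hg
    have hlt : 2 * k + g < N 0 := by omega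
    have := bil_change basisChange basisChange (fun q => embZ d 0 ⟨2 * k + g, hlt⟩ q)
      (fun q : Fin r => Ust (2 * s) (2 * k + g) q) (fun q j => embOnes x0 1 j q)
      (fun q j => embZ d 1 j q) (fun q j => embOnes x0 2 j q) (fun q j => embZ d 2 j q) ?_
    · intro j l
      have h := this j l
      simp only [bv, bw] at h
      simp only [dif_pos hlt]
      exact h
    · intro j l
      exact congrFun hJ (mkIdx ⟨2 * k + g, hlt⟩ j l)

lemma JL_congr {r : ℕ} {N : Fin 3 → ℕ} (U : Fin (N 0) → Fin r → ℝ) (x y : FreeIdx 3 r N → ℝ)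
    (h1 : ∀ j c, embOnes x 1 j c = embOnes y 1 j c) (h2 : ∀ j c, embOnes x 2 j c = embOnes y 2 j c) :
    JL U x = JL U y := by
  apply LinearMap.ext; intro d
  ext idx
  simp only [JL_apply, h1, h2]

lemma main_gen {r : ℕ} {N : Fin 3 → ℕ} (A s : ℕ) (hN : N 0 = 2 * A)
    (hr : r ≤ A * (2 * s)) (hb : 2 * s ≤ N 1) (hc : 2 * s ≤ N 2)
    (hcount : s * (2 * A + N 1 + N 2 - 2) ≤ N 1 * N 2) :
    ∃ P : MvPolynomial (FreeIdx 3 r N) ℝ, P ≠ 0 ∧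
      ∀ x : FreeIdx 3 r N → ℝ, MvPolynomial.eval x P ≠ 0 →
        Function.Injective (fderiv ℝ (cpVec (m := 3) (r := r) (N := N)) x) := by
  classical
  have exists_pt : ∃ x2 : FreeIdx 3 r N → ℝ, ∀ d, JL (embOnes x2 0) x2 d = 0 → d = 0 := by
    rcases Nat.eq_zero_or_pos s with rfl | hs
    · have hr0 : r = 0 := by simpa using hr
      subst hr0
      exact ⟨0, fun d _ => by ext p; exact p.1.2.2.elim0⟩
    have hP : ∀ k : Fin A, ∃ P : MvPolynomial (FreeIdx 3 r N) ℝ, P ≠ 0 ∧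
        ∀ x, MvPolynomial.eval x P ≠ 0 → ∀ d, (∀ p, p ∉ Sblk (2 * s) k → d p = 0) →
          JL (fun i c => Ust (2 * s) i c) x d = 0 → d = 0 := by
      intro k
      obtain ⟨x0, hx0⟩ := block_inj (r := r) (N := N) A s k hs k.2 hN hr hb hc hcount
      exact gen_inj (fun x => JL (fun i c => Ust (2 * s) i c) x)
        (fun p a => JL_poly (fun _ i c => Ust (2 * s) i c) (fun i c => IsPolyFn.const _) _ a)
        (Sblk (2 * s) k) x0 hx0
    choose P hP0 hP using hP
    have hprod : (∏ k, P k) ≠ 0 := Finset.prod_ne_zero_iff.2 fun k _ => hP0 k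
    obtain ⟨x1, hx1⟩ : ∃ x1, MvPolynomial.eval x1 (∏ k, P k) ≠ 0 := by
      by_contra! hcon
      exact hprod (MvPolynomial.funext fun x => by rw [hcon, map_zero])
    rw [map_prod, Finset.prod_ne_zero_iff] at hx1
    refine ⟨fun p => if (p.1.1 : ℕ) = 0 then Ust (2 * s) p.1.2.1 p.1.2.2 else x1 p, ?_⟩
    set x2 : FreeIdx 3 r N → ℝ := fun p => if (p.1.1 : ℕ) = 0 then
      Ust (2 * s) p.1.2.1 p.1.2.2 else x1 p with hx2
    have hU : embOnes x2 0 = fun (i : Fin (N 0)) (c : Fin r) => Ust (2 * s) i c := by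
      ext i c; simp [embOnes, hx2]
    rw [hU, JL_congr _ x2 x1 (fun j c => by simp [embOnes, hx2]) (fun j c => by simp [embOnes, hx2])]
    intro d hd
    have hdk : ∀ k : Fin A, (fun p => if p ∈ Sblk (2 * s) k then d p else 0) = 0 := by
      intro k
      apply hP k x1 (hx1 k (Finset.mem_univ _))
      · intro p hp; simp [hp]
      · ext idx
        have hidx := congrFun hd idx
        rw [JL_apply] at hidx ⊢
        have f0 : embZ (fun p => if p ∈ Sblk (2 * s) k then d p else 0) 0 = fun i c =>
            if ((i : Fin (N 0)) : ℕ) / 2 = k then embZ d 0 i c else 0 := by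
          ext i c
          simp [embZ, Sblk]
        have f1 : embZ (fun p => if p ∈ Sblk (2 * s) k then d p else 0) 1 = fun i (c : Fin r) =>
            if (c : ℕ) / (2 * s) = k then embZ d 1 i c else 0 := by
          ext i c
          by_cases hi : (i : ℕ) = 0 <;> simp [embZ, Sblk, hi]
        have f2 : embZ (fun p => if p ∈ Sblk (2 * s) k then d p else 0) 2 = fun i (c : Fin r) =>
            if (c : ℕ) / (2 * s) = k then embZ d 2 i c else 0 := by
          ext i c
          by_cases hi : (i : ℕ) = 0 <;> simp [embZ, Sblk, hi]
        rw [f0, f1, f2]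
        by_cases hi : ((idx 0 : Fin (N 0)) : ℕ) / 2 = k
        · refine Eq.trans (Finset.sum_congr rfl fun c _ => ?_) hidx
          simp only [Ust, hi, if_true]
          by_cases hck : (c : ℕ) / (2 * s) = k
          · simp [hck]
          · simp [hck]
            intro h
            exact absurd h.symm hck
        · apply Finset.sum_eq_zero
          intro c _
          simp only [Ust, hi, if_false]
          by_cases hck : (c : ℕ) / (2 * s) = k
          · simp [hck, hi]
          · simp [hck]
    ext p
    have hlt : ∃ k : Fin A, p ∈ Sblk (2 * s) k := by
      obtain ⟨⟨i, j, c⟩, h⟩ := p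
      by_cases hi : i = 0
      · subst hi
        have hj : (j : ℕ) < N 0 := j.2
        exact ⟨⟨(j : ℕ) / 2, by omega⟩, by simp [Sblk]⟩
      · refine ⟨⟨(c : ℕ) / (2 * s), ?_⟩, by simp [Sblk, hi]⟩
        rw [Nat.div_lt_iff_lt_mul (by omega)]
        omega
    obtain ⟨k, hk⟩ := hlt
    have := congrFun (hdk k) p
    simpa [hk] using this
  obtain ⟨x2, hx2⟩ := exists_pt
  obtain ⟨P, hP0, hP⟩ := gen_inj (fun x : FreeIdx 3 r N → ℝ => JL (embOnes x 0) x)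
    (fun p a => JL_poly (fun x => embOnes x 0) (fun i c => IsPolyFn.emb _ _ _) _ a)
    Set.univ x2 (fun d _ => hx2 d)
  refine ⟨P, hP0, fun x hx => ?_⟩
  rw [injective_iff_map_eq_zero]
  intro d hd
  rw [fderiv_cpVec] at hd
  exact hP x hx d (fun p hp => absurd (Set.mem_univ p) hp) hd

/-- Let `m = 3`, `N₁` even, `N₁ ≥ N₂ ≥ N₃ ≥ 3`, and
`r ≤ N₁·⌊N₂N₃/(N₁+N₂+N₃−2)⌋`.  Then for generic `Θ̃ = (U₁, Ũ₂, Ũ₃)` the Jacobian of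
`h(Θ̃) = vec([[U₁, [1ᵀ;Ũ₂], [1ᵀ;Ũ₃]]])` has full column rank (is injective as a linear map):
the bad set is contained in the zero set of a nonzero polynomial in the entries of `Θ̃`. -/
theorem cp_jacobian_full_rank_order3_even
    (N₁ N₂ N₃ r : ℕ) (heven : Even N₁) (h12 : N₂ ≤ N₁) (h23 : N₃ ≤ N₂) (h3 : 3 ≤ N₃)
    (hr : r ≤ N₁ * (N₂ * N₃ / (N₁ + N₂ + N₃ - 2))) :
    ∃ P : MvPolynomial (FreeIdx 3 r ![N₁, N₂, N₃]) ℝ, P ≠ 0 ∧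
      ∀ x : FreeIdx 3 r ![N₁, N₂, N₃] → ℝ,
        MvPolynomial.eval x P ≠ 0 →
        Function.Injective (fderiv ℝ (cpVec (m := 3) (r := r) (N := ![N₁, N₂, N₃])) x) := by
  obtain ⟨A, hA⟩ := heven
  have hdiv := Nat.div_mul_le_self (N₂ * N₃) (N₁ + N₂ + N₃ - 2)
  set s := N₂ * N₃ / (N₁ + N₂ + N₃ - 2) with hs
  have hc : 2 * s ≤ N₃ := by
    have h1 : s * (2 * N₂) ≤ s * (N₁ + N₂ + N₃ - 2) := Nat.mul_le_mul_left _ (by omega)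
    have h2 : N₂ * (2 * s) ≤ N₂ * N₃ := by linarith
    exact Nat.le_of_mul_le_mul_left h2 (by omega)
  refine main_gen (N := ![N₁, N₂, N₃]) A s ?_ ?_ ?_ ?_ ?_
  · show N₁ = 2 * A
    omega
  · have e : N₁ = 2 * A := by omega
    rw [e] at hr
    linarith
  · show 2 * s ≤ N₂
    omega
  · exact hc
  · show s * (2 * A + N₂ + N₃ - 2) ≤ N₂ * N₃
    have e : N₁ = 2 * A := by omega
    rw [← e]
    exact hdiv
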